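/- arXiv:0907.4534 — 3 statements merged into one kernel-verified Lean document; each statement's English description precedes it below -/
import Mathlib

section
/- There is an absolute constant C > 0 with the following property: let f : ℕ → ℂ be completely multiplicative with |f(m)| ≤ 1 for all m, and let (a_k) be the unique sequence with f(m) = Σ_{d∣m} a_d for all m. Then for every integer m ≥ 2, |S(m)| ≤ Σ_{k≤m} |f(k) − 1| Λ(k) ⌊m/k⌋ ≤ C m Σ_{p≤m} |f(p) − 1| (log p)/p, the last sum being over primes p ≤ m. -/
open Filter Finset

/-- `S a n = Σ_{k≤n} a_k ⌊n/k⌋ log k`. -/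
noncomputable def S (a : ℕ → ℂ) (n : ℕ) : ℂ :=
  ∑ k ∈ Finset.Icc 1 n, a k * ((n / k : ℕ) : ℂ) * (Real.log k : ℂ)

section

open scoped ArithmeticFunction.zeta ArithmeticFunction

namespace ArithmeticFunction

theorem pmul_mul_eq_of_map_mul {R : Type*} [CommSemiring R] (h f g : ArithmeticFunction R)
    (hh : ∀ m n : ℕ, h (m * n) = h m * h n) :
    h.pmul (f * g) = h.pmul f * h.pmul g := by
  ext n
  simp only [pmul_apply, mul_apply, mul_sum]
  refine sum_congr rfl fun x hx => ?_
  rw [← (Nat.mem_divisorsAntidiagonal.1 hx).1, hh]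
  ring

theorem pmul_mul_eq_of_map_mul_eq_add {R : Type*} [CommSemiring R] (h f g : ArithmeticFunction R)
    (hh : ∀ m n : ℕ, m ≠ 0 → n ≠ 0 → h (m * n) = h m + h n) :
    h.pmul (f * g) = h.pmul f * g + f * h.pmul g := by
  ext n
  simp only [pmul_apply, mul_apply, mul_sum, add_apply, ← sum_add_distrib]
  refine sum_congr rfl fun x hx => ?_
  obtain ⟨hn, hn0⟩ := Nat.mem_divisorsAntidiagonal.1 hx
  subst hn
  rw [hh _ _ (left_ne_zero_of_mul hn0) (right_ne_zero_of_mul hn0)]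
  ring

/-- The von Mangoldt function with complex values. -/
noncomputable def vonMangoldtComplex : ArithmeticFunction ℂ :=
  ⟨fun n => (Λ n : ℂ), by simp⟩

/-- The logarithm as an arithmetic function with complex values. -/
noncomputable def logComplex : ArithmeticFunction ℂ :=
  ⟨fun n => (Real.log n : ℂ), by simp⟩

theorem vonMangoldtComplex_mul_zeta :
    vonMangoldtComplex * (ζ : ArithmeticFunction ℂ) = logComplex := by
  ext n
  rw [coe_mul_zeta_apply]
  change ∑ i ∈ n.divisors, (Λ i : ℂ) = (Real.log n : ℂ)
  rw [← vonMangoldt_sum, Complex.ofReal_sum]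

theorem logComplex_map_mul (m n : ℕ) (hm : m ≠ 0) (hn : n ≠ 0) :
    logComplex (m * n) = logComplex m + logComplex n := by
  change (Real.log (m * n : ℕ) : ℂ) = (Real.log m : ℂ) + (Real.log n : ℂ)
  rw [Nat.cast_mul, Real.log_mul (by exact_mod_cast hm) (by exact_mod_cast hn), Complex.ofReal_add]

/-- If `f = a * ζ` is completely multiplicative, then
`(a log) * ζ = ((f - 1) Λ) * f` for the Dirichlet convolution. -/
theorem logComplex_pmul_mul_zeta (f a : ArithmeticFunction ℂ) (hf : a * ζ = f)
    (hmul : ∀ m n : ℕ, f (m * n) = f m * f n) :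
    logComplex.pmul a * ζ = (f.pmul vonMangoldtComplex - vonMangoldtComplex) * f := by
  have h₁ := pmul_mul_eq_of_map_mul_eq_add logComplex a ζ logComplex_map_mul
  have h₂ := pmul_mul_eq_of_map_mul f vonMangoldtComplex ζ hmul
  rw [pmul_zeta] at h₁ h₂
  rw [vonMangoldtComplex_mul_zeta, pmul_comm] at h₂
  rw [hf, h₂] at h₁
  have h₃ : a * logComplex = vonMangoldtComplex * f := by
    rw [← vonMangoldtComplex_mul_zeta, ← hf]; ring
  rw [sub_mul, h₁, h₃]
  ring

end ArithmeticFunction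

open ArithmeticFunction in
theorem S_eq_sum (f : ℕ → ℂ) (hmul : ∀ m n : ℕ, f (m * n) = f m * f n)
    (a : ℕ → ℂ) (ha : ∀ m : ℕ, 1 ≤ m → f m = ∑ d ∈ m.divisors, a d) (m : ℕ) :
    S a m = ∑ k ∈ Icc 1 m, (f k - 1) * (Λ k : ℂ) * ∑ j ∈ Icc 1 (m / k), f j := by
  have hIcc (n : ℕ) : Icc 1 n = Ioc 0 n := rfl
  let F : ArithmeticFunction ℂ := ⟨fun n => if n = 0 then 0 else f n, if_pos rfl⟩
  let A : ArithmeticFunction ℂ := ⟨fun n => if n = 0 then 0 else a n, if_pos rfl⟩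
  have hF {n : ℕ} (hn : n ≠ 0) : F n = f n := if_neg hn
  have hA {n : ℕ} (hn : n ≠ 0) : A n = a n := if_neg hn
  have hFA : A * ζ = F := by
    ext n
    rcases eq_or_ne n 0 with rfl | hn
    · simp
    rw [coe_mul_zeta_apply, hF hn, ha n (Nat.one_le_iff_ne_zero.2 hn)]
    exact sum_congr rfl fun d hd => hA (Nat.pos_of_mem_divisors hd).ne'
  have hFmul (m n : ℕ) : F (m * n) = F m * F n := by
    rcases eq_or_ne m 0 with rfl | hm
    · simp
    rcases eq_or_ne n 0 with rfl | hn
    · simp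
    rw [hF hm, hF hn, hF (mul_ne_zero hm hn), hmul]
  have key := congrArg (fun g : ArithmeticFunction ℂ => ∑ n ∈ Ioc 0 m, g n)
    (logComplex_pmul_mul_zeta F A hFA hFmul)
  beta_reduce at key
  rw [sum_Ioc_mul_zeta_eq_sum, sum_Ioc_mul_eq_sum_sum] at key
  rw [S]
  simp only [hIcc]
  convert key using 1
  · refine sum_congr rfl fun k hk => ?_
    rw [pmul_apply, hA (mem_Ioc.1 hk).1.ne']
    change _ = (Real.log k : ℂ) * a k * _
    ring
  · refine sum_congr rfl fun k hk => ?_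
    rw [sub_eq_add_neg (F.pmul _), ArithmeticFunction.add_apply,
      ArithmeticFunction.neg_apply, pmul_apply, hF (mem_Ioc.1 hk).1.ne']
    change _ = (f k * (Λ k : ℂ) + -(Λ k : ℂ)) * _
    rw [sum_congr rfl fun j hj => hF (mem_Ioc.1 hj).1.ne']
    ring

theorem norm_S_le (f : ℕ → ℂ) (hmul : ∀ m n : ℕ, f (m * n) = f m * f n)
    (hf : ∀ m : ℕ, ‖f m‖ ≤ 1) (a : ℕ → ℂ)
    (ha : ∀ m : ℕ, 1 ≤ m → f m = ∑ d ∈ m.divisors, a d) (m : ℕ) :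
    ‖S a m‖ ≤ ∑ k ∈ Icc 1 m, ‖f k - 1‖ * Λ k * ((m / k : ℕ) : ℝ) := by
  rw [S_eq_sum f hmul a ha]
  refine norm_sum_le_of_le _ fun k _ => ?_
  rw [norm_mul, norm_mul, Complex.norm_real,
    Real.norm_of_nonneg ArithmeticFunction.vonMangoldt_nonneg]
  have hΛ : 0 ≤ Λ k := ArithmeticFunction.vonMangoldt_nonneg
  gcongr
  simpa using norm_sum_le_of_le (Icc 1 (m / k)) fun j _ => hf j

theorem norm_pow_sub_one_le {z : ℂ} (hz : ‖z‖ ≤ 1) (j : ℕ) : ‖z ^ j - 1‖ ≤ j * ‖z - 1‖ := by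
  rw [← geom_sum_mul, norm_mul]
  gcongr
  simpa using norm_sum_le_of_le (range j) fun i _ =>
    (norm_pow z i).trans_le (pow_le_one₀ (norm_nonneg z) hz)

theorem sum_mul_pow_inv_le {x : ℝ} (hx : 2 ≤ x) (s : Finset ℕ) :
    ∑ j ∈ s, j * x⁻¹ ^ j ≤ 4 / x := by
  have hx0 : 0 < x := by linarith
  have hr : ‖x⁻¹‖ < 1 := by
    rw [Real.norm_of_nonneg (by positivity)]
    exact inv_lt_one_of_one_lt₀ (by linarith)
  have hsum := hasSum_coe_mul_geometric_of_norm_lt_one hr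
  refine (sum_le_hasSum s (fun j _ => by positivity) hsum).trans ?_
  have h : 1 / 2 ≤ 1 - x⁻¹ := by
    have := inv_anti₀ two_pos hx
    linarith
  calc x⁻¹ / (1 - x⁻¹) ^ 2 ≤ x⁻¹ / (1 / 2) ^ 2 := by gcongr
    _ = 4 / x := by ring

theorem sum_vonMangoldt_le (f : ℕ → ℂ) (h1 : f 1 = 1)
    (hmul : ∀ m n : ℕ, f (m * n) = f m * f n) (hf : ∀ m : ℕ, ‖f m‖ ≤ 1) (m : ℕ) :
    ∑ k ∈ Icc 1 m, ‖f k - 1‖ * Λ k * ((m / k : ℕ) : ℝ) ≤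
      4 * m * ∑ p ∈ (range (m + 1)).filter Nat.Prime, ‖f p - 1‖ * Real.log p / p := by
  let g : ℕ → ℝ := fun k => ‖f k - 1‖ * Λ k / k
  have hg (k : ℕ) : 0 ≤ g k :=
    div_nonneg (mul_nonneg (norm_nonneg _) ArithmeticFunction.vonMangoldt_nonneg) k.cast_nonneg
  have hpow (n j : ℕ) : f (n ^ j) = f n ^ j := by
    induction j with
    | zero => simpa using h1
    | succ j ih => rw [pow_succ, hmul, ih, pow_succ]
  have hgp {p : ℕ} (hp : p.Prime) {j : ℕ} (hj : j ≠ 0) :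
      g (p ^ j) ≤ ‖f p - 1‖ * Real.log p * (j * (p : ℝ)⁻¹ ^ j) := by
    simp only [g]
    rw [ArithmeticFunction.vonMangoldt_apply_pow hj,
      ArithmeticFunction.vonMangoldt_apply_prime hp, hpow, div_eq_mul_inv, Nat.cast_pow, ← inv_pow]
    have hlog : 0 ≤ Real.log p := Real.log_natCast_nonneg p
    calc ‖f p ^ j - 1‖ * Real.log p * (p : ℝ)⁻¹ ^ j
        ≤ (j * ‖f p - 1‖) * Real.log p * (p : ℝ)⁻¹ ^ j := by
          gcongr
          exact norm_pow_sub_one_le (hf p) j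
      _ = _ := by ring
  set P := (range (m + 1)).filter Nat.Prime
  obtain ⟨N, hN⟩ : ∃ N, ∑ k ∈ Ioc 0 m with IsPrimePow k, g k ≤
      ∑ j ∈ Icc 1 N, ∑ p ∈ P, g (p ^ j) := by
    have h := Chebyshev.sum_PrimePow_eq_sum_sum g (Nat.cast_nonneg (α := ℝ) m)
    rw [Nat.floor_natCast] at h
    refine ⟨_, h.trans_le (sum_le_sum fun j hj => ?_)⟩
    refine sum_le_sum_of_subset_of_nonneg (fun p hp => ?_) fun _ _ _ => hg _
    obtain ⟨hp, hpp⟩ := mem_filter.1 hp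
    refine mem_filter.2 ⟨mem_range_succ_iff.2 ?_, hpp⟩
    have hj : 1 ≤ j := (mem_Icc.1 hj).1
    have hm : (1 : ℝ) ≤ m := by
      rcases Nat.eq_zero_or_pos m with rfl | hm
      · rw [Nat.cast_zero, Real.zero_rpow (by positivity)] at hp
        simp at hp
      · exact_mod_cast hm
    have := (mem_Ioc.1 hp).2
    rw [Nat.le_floor_iff (by positivity)] at this
    have h' : (m : ℝ) ^ ((1 : ℝ) / j) ≤ m := by
      refine (Real.rpow_le_rpow_of_exponent_le hm ?_).trans_eq (Real.rpow_one _)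
      rw [div_le_one (by positivity)]
      exact_mod_cast hj
    exact_mod_cast this.trans h'
  calc ∑ k ∈ Icc 1 m, ‖f k - 1‖ * Λ k * ((m / k : ℕ) : ℝ)
      ≤ ∑ k ∈ Icc 1 m, m * g k := by
        refine sum_le_sum fun k _ => ?_
        have hΛ : 0 ≤ Λ k := ArithmeticFunction.vonMangoldt_nonneg
        calc ‖f k - 1‖ * Λ k * ((m / k : ℕ) : ℝ) ≤ ‖f k - 1‖ * Λ k * ((m : ℝ) / k) := by
              gcongr
              exact Nat.cast_div_le
          _ = m * g k := by simp only [g]; ring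
    _ = m * ∑ k ∈ Ioc 0 m with IsPrimePow k, g k := by
        rw [← mul_sum, sum_filter_of_ne]
        · rfl
        · intro k _ hk
          rw [← ArithmeticFunction.vonMangoldt_ne_zero_iff]
          rintro h0
          simp [g, h0] at hk
    _ ≤ m * ∑ j ∈ Icc 1 N, ∑ p ∈ P, g (p ^ j) := by gcongr
    _ = m * ∑ p ∈ P, ∑ j ∈ Icc 1 N, g (p ^ j) := by rw [sum_comm]
    _ ≤ m * ∑ p ∈ P, ‖f p - 1‖ * Real.log p * (4 / p) := by
        gcongr with p hp
        have hp : p.Prime := (mem_filter.1 hp).2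
        have hlog : 0 ≤ Real.log p := Real.log_natCast_nonneg p
        calc ∑ j ∈ Icc 1 N, g (p ^ j)
            ≤ ∑ j ∈ Icc 1 N, ‖f p - 1‖ * Real.log p * (j * (p : ℝ)⁻¹ ^ j) :=
              sum_le_sum fun j hj => hgp hp (Nat.one_le_iff_ne_zero.1 (mem_Icc.1 hj).1)
          _ ≤ ‖f p - 1‖ * Real.log p * (4 / p) := by
              rw [← mul_sum]
              gcongr
              exact sum_mul_pow_inv_le (by exact_mod_cast hp.two_le) _
    _ = 4 * m * ∑ p ∈ P, ‖f p - 1‖ * Real.log p / p := by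
        rw [mul_comm (4 : ℝ), mul_assoc, mul_sum _ _ (4 : ℝ)]
        congr 1
        exact sum_congr rfl fun p _ => by ring

end

/-- There is an absolute `C > 0` such that: for every completely
multiplicative `f : ℕ → ℂ` with `|f(m)| ≤ 1`, and `a` the sequence with
`f(m) = Σ_{d∣m} a_d`, for every `m ≥ 2`,
`|S(m)| ≤ Σ_{k≤m} |f(k) − 1| Λ(k) ⌊m/k⌋ ≤ C m Σ_{p≤m} |f(p) − 1| (log p)/p`. -/
theorem stmt_17 :
    ∃ C : ℝ, 0 < C ∧ ∀ f : ℕ → ℂ, f 1 = 1 → (∀ m n : ℕ, f (m * n) = f m * f n) →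
      (∀ m : ℕ, ‖f m‖ ≤ 1) → ∀ a : ℕ → ℂ, (∀ m : ℕ, 1 ≤ m → f m = ∑ d ∈ m.divisors, a d) →
      ∀ m : ℕ, 2 ≤ m →
        ‖S a m‖ ≤ ∑ k ∈ Finset.Icc 1 m,
            ‖f k - 1‖ * ArithmeticFunction.vonMangoldt k * ((m / k : ℕ) : ℝ) ∧
        ∑ k ∈ Finset.Icc 1 m,
            ‖f k - 1‖ * ArithmeticFunction.vonMangoldt k * ((m / k : ℕ) : ℝ) ≤
          C * m * ∑ p ∈ (Finset.range (m + 1)).filter Nat.Prime,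
            ‖f p - 1‖ * Real.log p / p := by
  exact ⟨4, four_pos, fun f h1 hmul hf a ha m _ =>
    ⟨norm_S_le f hmul hf a ha m, sum_vonMangoldt_le f h1 hmul hf m⟩⟩
end

section
/- Let (a_n)_{n≥0} be a sequence of complex numbers satisfying Σ_{k=0}^n k a_k = o(n) as n → ∞. Then the power series φ(z) = Σ_{j=0}^∞ a_j z^j converges for all real z with 0 ≤ z < 1, and Σ_{k=0}^n a_k = φ(e^{−1/n}) + o(1) as n → ∞. -/
open Filter Finset

/-- A sequence that is `o(n)` is bounded by `ε n + M` for every `ε > 0` and a suitable `M`. -/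
lemma exists_norm_le_mul_add_of_isLittleO {S : ℕ → ℂ}
    (h : S =o[atTop] (fun n : ℕ => (n : ℝ))) {ε : ℝ} (hε : 0 < ε) :
    ∃ M : ℝ, 0 ≤ M ∧ ∀ j, ‖S j‖ ≤ ε * j + M := by
  obtain ⟨N, hN⟩ := eventually_atTop.1 (h.bound hε)
  refine ⟨∑ i ∈ range N, ‖S i‖, sum_nonneg fun i _ => norm_nonneg _, fun j => ?_⟩
  rcases lt_or_ge j N with hj | hj
  · have h1 := single_le_sum (f := fun i => ‖S i‖) (fun i _ => norm_nonneg _) (mem_range.2 hj)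
    have h2 : 0 ≤ ε * (j : ℝ) := by positivity
    linarith
  · have h1 := hN j hj
    have h2 : 0 ≤ ∑ i ∈ range N, ‖S i‖ := sum_nonneg fun i _ => norm_nonneg _
    simp only [Real.norm_natCast] at h1
    linarith

/-- If the partial sums of `k a_k` grow at most linearly, then `∑ a_j z^j` converges for
`0 ≤ z < 1`. -/
lemma summable_mul_pow_of_norm_sum_mul_le {a : ℕ → ℂ} {C M : ℝ} (hC : 0 ≤ C) (hM : 0 ≤ M)
    (hS : ∀ j : ℕ, ‖∑ k ∈ range (j + 1), (k : ℂ) * a k‖ ≤ C * j + M)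
    {z : ℝ} (hz0 : 0 ≤ z) (hz1 : z < 1) : Summable fun j : ℕ => a j * (z : ℂ) ^ j := by
  have hbound : ∀ j, ‖a (j + 1)‖ ≤ 2 * (C + M) := by
    intro j
    have h1 : ((j + 1 : ℕ) : ℂ) * a (j + 1) = (∑ k ∈ range (j + 1 + 1), (k : ℂ) * a k)
        - ∑ k ∈ range (j + 1), (k : ℂ) * a k := by
      rw [sum_range_succ _ (j + 1)]; ring
    have h2 : ((j : ℝ) + 1) * ‖a (j + 1)‖ ≤ (C * (j + 1) + M) + (C * j + M) := by
      have h3 := norm_sub_le (∑ k ∈ range (j + 1 + 1), (k : ℂ) * a k)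
        (∑ k ∈ range (j + 1), (k : ℂ) * a k)
      rw [← h1, norm_mul, Complex.norm_natCast] at h3
      have h4 := hS j
      have h5 := hS (j + 1)
      push_cast at h3 h4 h5 ⊢
      linarith
    have hj : (0 : ℝ) ≤ j := j.cast_nonneg
    by_contra! hlt
    have := mul_lt_mul_of_pos_left hlt (by positivity : (0 : ℝ) < j + 1)
    nlinarith [mul_nonneg hM hj]
  rw [← summable_nat_add_iff 1]
  refine Summable.of_norm_bounded
    (((summable_geometric_of_lt_one hz0 hz1).mul_left (2 * (C + M)))) fun j => ?_
  rw [norm_mul, norm_pow, Complex.norm_real, Real.norm_of_nonneg hz0]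
  exact mul_le_mul (hbound j) (pow_le_pow_of_le_one hz0 hz1.le (Nat.le_succ j)) (by positivity)
    (by positivity)

/-- Summation by parts for `∑ a_j w_j`, in terms of the partial sums of `k a_k`. -/
lemma sum_mul_eq_sum_partial_mul_sub (a w : ℕ → ℂ) (hw : w 0 = 0) (N : ℕ) :
    ∑ j ∈ range (N + 1), a j * w j
      = (∑ j ∈ range (N + 1), (∑ k ∈ range (j + 1), (k : ℂ) * a k)
          * (w j / j - w (j + 1) / ((j + 1 : ℕ) : ℂ)))
        + (∑ k ∈ range (N + 1), (k : ℂ) * a k) * (w (N + 1) / ((N + 1 : ℕ) : ℂ)) := by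
  induction N with
  | zero => simp [hw]
  | succ N ih =>
    rw [sum_range_succ, ih, sum_range_succ _ (N + 1),
      sum_range_succ (fun k => (k : ℂ) * a k) (N + 1)]
    have : ((N + 1 : ℕ) : ℂ) ≠ 0 := Nat.cast_ne_zero.2 N.succ_ne_zero
    field_simp
    ring

/-- The weight `1_{j ≤ n} - x^j`. -/
def cutoffWeight (x : ℝ) (n j : ℕ) : ℝ := if j ≤ n then 1 - x ^ j else -x ^ j

lemma one_sub_pow_sub_mul_mem_Icc {x : ℝ} (hx0 : 0 ≤ x) (hx1 : x ≤ 1) (j : ℕ) :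
    1 - x ^ j - j * x ^ j * (1 - x) ∈ Set.Icc 0 ((1 - x) ^ 2 * (j * (j + 1))) := by
  induction j with
  | zero => simp
  | succ j ih =>
    obtain ⟨h1, h2⟩ := ih
    have hp0 : 0 ≤ x ^ j := by positivity
    have hp1 : x ^ j ≤ 1 := pow_le_one₀ hx0 hx1
    have key : 1 - x ^ (j + 1) - ((j + 1 : ℕ) : ℝ) * x ^ (j + 1) * (1 - x)
        = (1 - x ^ j - j * x ^ j * (1 - x)) + ((1 - x) ^ 2 * (j + 1)) * x ^ j := by
      push_cast; ring
    have h3 : 0 ≤ (1 - x) ^ 2 * ((j : ℝ) + 1) := by positivity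
    have h4 := mul_le_mul_of_nonneg_left hp1 h3
    have h5 := mul_nonneg h3 hp0
    rw [key]
    constructor
    · linarith
    · push_cast
      nlinarith

lemma abs_cutoffWeight_le_one {x : ℝ} (hx0 : 0 ≤ x) (hx1 : x ≤ 1) (n j : ℕ) :
    |cutoffWeight x n j| ≤ 1 := by
  have hp0 : 0 ≤ x ^ j := by positivity
  have hp1 : x ^ j ≤ 1 := pow_le_one₀ hx0 hx1
  unfold cutoffWeight
  split_ifs <;> rw [abs_le] <;> constructor <;> linarith

lemma abs_cutoffWeight_div_sub_le {x : ℝ} {n j : ℕ} (hx0 : 0 ≤ x) (hx1 : x ≤ 1) (hn : 1 ≤ n)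
    (hy : 1 - x ≤ 1 / n) (hxn : 1 / 3 ≤ x ^ n) (hj : 1 ≤ j) :
    |cutoffWeight x n j / j - cutoffWeight x n (j + 1) / ((j + 1 : ℕ) : ℝ)|
      ≤ 3 * x ^ j / n ^ 2 + if j = n then 2 / (n : ℝ) else 0 := by
  have hn' : (1 : ℝ) ≤ n := by exact_mod_cast hn
  have hj' : (1 : ℝ) ≤ j := by exact_mod_cast hj
  have hp0 : 0 ≤ x ^ j := by positivity
  have hn0 : (0 : ℝ) < n := by linarith
  have hj0 : (0 : ℝ) < j := by linarith
  rcases lt_trichotomy j n with hlt | rfl | hgt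
  · obtain ⟨h1, h2⟩ := one_sub_pow_sub_mul_mem_Icc hx0 hx1 j
    have heq : cutoffWeight x n j / j - cutoffWeight x n (j + 1) / ((j + 1 : ℕ) : ℝ)
        = (1 - x ^ j - j * x ^ j * (1 - x)) / (j * (j + 1)) := by
      rw [cutoffWeight, cutoffWeight, if_pos hlt.le, if_pos (Nat.succ_le_of_lt hlt)]
      push_cast
      field_simp
      ring
    rw [heq, abs_of_nonneg (by positivity), if_neg hlt.ne, add_zero]
    have h3 : x ^ n ≤ x ^ j := pow_le_pow_of_le_one hx0 hx1 hlt.le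
    calc _ ≤ (1 - x) ^ 2 := by rw [div_le_iff₀ (by positivity)]; exact h2
      _ ≤ (1 / n : ℝ) ^ 2 := by gcongr
      _ = 1 / n ^ 2 := by ring
      _ ≤ _ := by gcongr; linarith
  · rw [if_pos rfl]
    have h1 : |cutoffWeight x j j / j| ≤ 1 / j := by
      rw [abs_div, Nat.abs_cast]
      gcongr
      exact abs_cutoffWeight_le_one hx0 hx1 _ _
    have h2 : |cutoffWeight x j (j + 1) / ((j + 1 : ℕ) : ℝ)| ≤ 1 / j := by
      rw [abs_div, Nat.abs_cast]
      gcongr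
      · exact abs_cutoffWeight_le_one hx0 hx1 _ _
      · exact Nat.le_succ j
    have h3 : 0 ≤ 3 * x ^ j / (j : ℝ) ^ 2 := by positivity
    have h4 : 2 / (j : ℝ) = 1 / j + 1 / j := by ring
    have h5 := abs_sub (cutoffWeight x j j / j) (cutoffWeight x j (j + 1) / ((j + 1 : ℕ) : ℝ))
    linarith
  · have hnj : (n : ℝ) ≤ j := by exact_mod_cast hgt.le
    have heq : cutoffWeight x n j / j - cutoffWeight x n (j + 1) / ((j + 1 : ℕ) : ℝ)
        = -(x ^ j * ((1 + j * (1 - x)) / (j * (j + 1)))) := by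
      rw [cutoffWeight, cutoffWeight, if_neg (by omega), if_neg (by omega)]
      push_cast
      field_simp
      ring
    have hy0 : 0 ≤ 1 - x := by linarith
    rw [heq, abs_neg, abs_of_nonneg (by positivity), if_neg hgt.ne', add_zero]
    have h1 : (1 + j * (1 - x)) / (j * (j + 1)) ≤ 3 / (n : ℝ) ^ 2 := by
      have h2 : n * (1 - x) ≤ 1 := by
        rw [le_div_iff₀ hn0] at hy; linarith
      rw [div_le_div_iff₀ (by positivity) (by positivity)]
      have h3 : (n : ℝ) ^ 2 ≤ j * (j + 1) := by nlinarith
      have h4 : j * (1 - x) * (n : ℝ) ^ 2 ≤ j * (j + 1) := by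
        calc j * (1 - x) * (n : ℝ) ^ 2 = j * n * (n * (1 - x)) := by ring
          _ ≤ j * n * 1 := by gcongr
          _ ≤ j * (j + 1) := by nlinarith
      nlinarith [mul_pos hj0 hj0]
    calc _ ≤ x ^ j * (3 / (n : ℝ) ^ 2) := by gcongr
      _ = _ := by ring

lemma sum_linear_mul_pow_le {x ε M : ℝ} (hx0 : 0 ≤ x) (hx1 : x < 1) (hε : 0 ≤ ε) (hM : 0 ≤ M)
    (N : ℕ) : ∑ j ∈ range N, (ε * j + M) * x ^ j ≤ ε * (1 / (1 - x) ^ 2) + M * (1 / (1 - x)) := by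
  have hx : ‖x‖ < 1 := by rwa [Real.norm_of_nonneg hx0]
  have h1 := ((hasSum_coe_mul_geometric_of_norm_lt_one hx).mul_left ε).add
    ((hasSum_geometric_of_lt_one hx0 hx1).mul_left M)
  have h2 := sum_le_hasSum (range N) (fun j _ => by positivity) h1
  have hy : 0 < 1 - x := by linarith
  calc _ = ∑ j ∈ range N, (ε * (j * x ^ j) + M * x ^ j) := by congr! 1; ring
    _ ≤ _ := h2
    _ ≤ _ := by rw [← one_div]; gcongr

lemma norm_partial_sum_sub_tsum_le {a : ℕ → ℂ} {ε M x : ℝ} {n : ℕ} (hε : 0 ≤ ε) (hM : 0 ≤ M)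
    (hS : ∀ j : ℕ, ‖∑ k ∈ range (j + 1), (k : ℂ) * a k‖ ≤ ε * j + M)
    (hx0 : 0 ≤ x) (hx1 : x < 1) (hn : 1 ≤ n) (hy : 1 - x ≤ 1 / n) (hy' : 1 / (1 - x) ≤ 2 * n)
    (hxn : 1 / 3 ≤ x ^ n) :
    ‖(∑ k ∈ range (n + 1), a k) - ∑' j : ℕ, a j * (x : ℂ) ^ j‖ ≤ 14 * ε + 8 * M / n := by
  have hn0 : (0 : ℝ) < n := by exact_mod_cast hn
  have hy0 : 0 < 1 - x := by linarith
  have hfin : ∀ N, n ≤ N → (∑ k ∈ range (n + 1), a k) - ∑ j ∈ range (N + 1), a j * (x : ℂ) ^ j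
      = ∑ j ∈ range (N + 1), a j * (cutoffWeight x n j : ℂ) := by
    intro N hN
    have h1 : ∑ k ∈ range (n + 1), a k = ∑ j ∈ range (N + 1), if j ≤ n then a j else 0 := by
      rw [← sum_filter]
      congr 1
      ext j
      simp only [mem_range, mem_filter]
      omega
    rw [h1, ← sum_sub_distrib]
    refine sum_congr rfl fun j _ => ?_
    unfold cutoffWeight
    split_ifs <;> push_cast <;> ring
  have hmain : ∀ N, n ≤ N → ‖∑ j ∈ range (N + 1), a j * (cutoffWeight x n j : ℂ)‖
      ≤ 14 * ε + 8 * M / n + (ε + M) * x ^ (N + 1) := by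
    intro N hN
    rw [sum_mul_eq_sum_partial_mul_sub a _ (by simp [cutoffWeight])]
    refine (norm_add_le _ _).trans (add_le_add ?_ ?_)
    · refine (norm_sum_le _ _).trans ?_
      calc _ ≤ ∑ j ∈ range (N + 1), ((3 / (n : ℝ) ^ 2) * ((ε * j + M) * x ^ j)
            + if j = n then (ε * n + M) * (2 / n) else 0) := by
            refine sum_le_sum fun j _ => ?_
            rcases Nat.eq_zero_or_pos j with rfl | hj
            · simp only [zero_add, sum_range_one, Nat.cast_zero, zero_mul, norm_zero]
              positivity
            · have h1 := abs_cutoffWeight_div_sub_le hx0 hx1.le hn hy hxn hj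
              rw [norm_mul]
              have h2 : ‖(cutoffWeight x n j : ℂ) / j
                  - (cutoffWeight x n (j + 1) : ℂ) / ((j + 1 : ℕ) : ℂ)‖
                  = |cutoffWeight x n j / j - cutoffWeight x n (j + 1) / ((j + 1 : ℕ) : ℝ)| := by
                rw [← Real.norm_eq_abs, ← Complex.norm_real]
                push_cast
                rfl
              rw [h2]
              refine (mul_le_mul (hS j) h1 (abs_nonneg _) (by positivity)).trans (le_of_eq ?_)
              split_ifs with h
              · subst h; ring
              · ring
        _ = (3 / (n : ℝ) ^ 2) * ∑ j ∈ range (N + 1), (ε * j + M) * x ^ j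
            + (ε * n + M) * (2 / n) := by
            rw [sum_add_distrib, ← mul_sum, sum_ite_eq', if_pos (mem_range.2 (by omega))]
        _ ≤ (3 / (n : ℝ) ^ 2) * (ε * (2 * n) ^ 2 + M * (2 * n)) + (ε * n + M) * (2 / n) := by
            have h1 := sum_linear_mul_pow_le hx0 hx1 hε hM (N + 1)
            have h2 : 1 / (1 - x) ^ 2 ≤ (2 * n : ℝ) ^ 2 := by
              rw [← one_div_pow]; gcongr
            gcongr
            refine h1.trans ?_
            gcongr
        _ = _ := by field_simp; ring
    · have h1 : ‖(cutoffWeight x n (N + 1) : ℂ) / ((N + 1 : ℕ) : ℂ)‖ = x ^ (N + 1) / (N + 1) := by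
        rw [cutoffWeight, if_neg (by omega), norm_div, Complex.norm_real, Complex.norm_natCast,
          norm_neg, Real.norm_of_nonneg (by positivity)]
        push_cast
        rfl
      rw [norm_mul, h1]
      have hN0 : (0 : ℝ) ≤ N := N.cast_nonneg
      calc _ ≤ (ε * N + M) * (x ^ (N + 1) / (N + 1)) := by gcongr; exact hS N
        _ ≤ ((ε + M) * (N + 1)) * (x ^ (N + 1) / (N + 1)) := by
            gcongr
            nlinarith [mul_nonneg hM hN0]
        _ = _ := by field_simp
  have hsum := (summable_mul_pow_of_norm_sum_mul_le hε hM hS hx0 hx1).hasSum.tendsto_sum_nat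
  have hlim := ((hsum.comp (tendsto_add_atTop_nat 1)).const_sub (∑ k ∈ range (n + 1), a k)).norm
  have hpow : Tendsto (fun N : ℕ => 14 * ε + 8 * M / n + (ε + M) * x ^ (N + 1)) atTop
      (nhds (14 * ε + 8 * M / n)) := by
    have := (((tendsto_pow_atTop_nhds_zero_of_lt_one hx0 hx1).comp
      (tendsto_add_atTop_nat 1)).const_mul (ε + M)).const_add (14 * ε + 8 * M / n)
    simpa using this
  refine le_of_tendsto_of_tendsto hlim hpow ?_
  filter_upwards [eventually_ge_atTop n] with N hN
  simp only [Function.comp_apply]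
  rw [hfin N hN]
  exact hmain N hN

/-- If `Σ_{k=0}^n k a_k = o(n)`, then the power series
`φ(z) = Σ_j a_j z^j` converges for all real `0 ≤ z < 1`, and
`Σ_{k=0}^n a_k = φ(e^{−1/n}) + o(1)` as `n → ∞`. -/
theorem stmt_18 (a : ℕ → ℂ)
    (h : (fun n : ℕ => ∑ k ∈ Finset.range (n + 1), (k : ℂ) * a k)
      =o[atTop] (fun n : ℕ => (n : ℝ))) :
    (∀ z : ℝ, 0 ≤ z → z < 1 → Summable (fun j : ℕ => a j * (z : ℂ) ^ j)) ∧
    Tendsto (fun n : ℕ => (∑ k ∈ Finset.range (n + 1), a k)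
        - ∑' j : ℕ, a j * ((Real.exp (-1 / (n : ℝ)) : ℝ) : ℂ) ^ j) atTop (nhds 0) := by
  refine ⟨fun z hz0 hz1 => ?_, ?_⟩
  · obtain ⟨M, hM, hS⟩ := exists_norm_le_mul_add_of_isLittleO h one_pos
    exact summable_mul_pow_of_norm_sum_mul_le zero_le_one hM hS hz0 hz1
  · rw [Metric.tendsto_nhds]
    intro δ hδ
    obtain ⟨M, hM, hS⟩ := exists_norm_le_mul_add_of_isLittleO h (by positivity : 0 < δ / 28)
    have hsmall : ∀ᶠ n : ℕ in atTop, 8 * M / n < δ / 2 :=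
      (tendsto_const_div_atTop_nhds_zero_nat (8 * M)).eventually_lt_const (by positivity)
    filter_upwards [hsmall, eventually_ge_atTop 1] with n hn hn1
    have hn' : (1 : ℝ) ≤ n := by exact_mod_cast hn1
    have hn0 : (0 : ℝ) < n := by linarith
    have hx1 : Real.exp (-1 / (n : ℝ)) < 1 :=
      Real.exp_lt_one_iff.2 (div_neg_of_neg_of_pos (by norm_num) hn0)
    have hy : 1 - Real.exp (-1 / (n : ℝ)) ≤ 1 / n := by
      have := Real.add_one_le_exp (-1 / (n : ℝ))
      rw [neg_div] at this ⊢
      linarith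
    have hxle : Real.exp (-1 / (n : ℝ)) ≤ n / (n + 1) := by
      have h1 := Real.add_one_le_exp (1 / (n : ℝ))
      rw [neg_div, Real.exp_neg]
      calc _ ≤ (1 / (n : ℝ) + 1)⁻¹ := by gcongr
        _ = _ := by field_simp; ring
    have hy' : 1 / (1 - Real.exp (-1 / (n : ℝ))) ≤ 2 * n := by
      have h1 : 1 / ((n : ℝ) + 1) ≤ 1 - Real.exp (-1 / (n : ℝ)) := by
        have : 1 / ((n : ℝ) + 1) = 1 - n / (n + 1) := by field_simp; ring
        linarith
      calc _ ≤ 1 / (1 / ((n : ℝ) + 1)) := by gcongr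
        _ = n + 1 := by rw [one_div_one_div]
        _ ≤ _ := by linarith
    have hxn : 1 / 3 ≤ Real.exp (-1 / (n : ℝ)) ^ n := by
      rw [← Real.exp_nat_mul, mul_div_cancel₀ _ hn0.ne', Real.exp_neg, one_div]
      gcongr
      linarith [Real.exp_one_lt_d9]
    have := norm_partial_sum_sub_tsum_le (by positivity) hM hS (Real.exp_nonneg _) hx1 hn1 hy
      hy' hxn
    rw [dist_zero_right]
    linarith
end

section
/- Let f : ℕ → ℂ be completely multiplicative with |f(m)| ≤ 1 for all m, and suppose that Σ_{p≤n} |f(p) − 1| (log p)/p = o(log n) as n → ∞ (sum over primes p ≤ n). Then (1/n) Σ_{m=1}^n f(m) = Π_p (1 − p^{−(1+1/log n)})/(1 − f(p) p^{−(1+1/log n)}) + o(1) as n → ∞, where the product is over all primes p (it converges absolutely since 1 + 1/log n > 1). -/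
open Filter Finset

namespace MeanValue

open ArithmeticFunction

open scoped ArithmeticFunction.zeta ArithmeticFunction.Moebius

/-- The arithmetic function `n ↦ a n / n`. -/
noncomputable def divId {R : Type*} [Field R] (a : ArithmeticFunction R) : ArithmeticFunction R :=
  ⟨fun n => a n / (n : R), by simp⟩

theorem divId_apply {R : Type*} [Field R] (a : ArithmeticFunction R) (n : ℕ) :
    divId a n = a n / (n : R) := rfl

theorem divId_mul {R : Type*} [Field R] (a b : ArithmeticFunction R) :
    divId (a * b) = divId a * divId b := by
  ext n
  rw [divId_apply, mul_apply, mul_apply, sum_div]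
  refine sum_congr rfl fun x hx => ?_
  rw [← (Nat.mem_divisorsAntidiagonal.mp hx).1, divId_apply, divId_apply, Nat.cast_mul,
    div_mul_div_comm]

theorem sum_mul_div_eq {R : Type*} [Field R] (a b : ArithmeticFunction R) (N : ℕ) :
    ∑ n ∈ Ioc 0 N, (a * b) n / (n : R) =
      ∑ n ∈ Ioc 0 N, a n / (n : R) * ∑ m ∈ Ioc 0 (N / n), b m / (m : R) := by
  simp only [← divId_apply, divId_mul, sum_Ioc_mul_eq_sum_sum]

/-- The natural logarithm as a complex-valued arithmetic function. -/
noncomputable def logC : ArithmeticFunction ℂ := ⟨fun n => (Real.log n : ℂ), by simp⟩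

/-- The von Mangoldt function as a complex-valued arithmetic function. -/
noncomputable def vonMangoldtC : ArithmeticFunction ℂ := ⟨fun n => ((Λ n : ℝ) : ℂ), by simp⟩

theorem vonMangoldtC_mul_zeta : vonMangoldtC * (ζ : ArithmeticFunction ℂ) = logC := by
  ext n
  rw [coe_mul_zeta_apply]
  simp only [vonMangoldtC, logC, coe_mk]
  rw [← vonMangoldt_sum, Complex.ofReal_sum]

theorem logC_pmul_mul (a b : ArithmeticFunction ℂ) :
    logC.pmul (a * b) = logC.pmul a * b + a * logC.pmul b := by
  ext n
  simp only [pmul_apply, mul_apply, ArithmeticFunction.add_apply, mul_sum, ← sum_add_distrib]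
  refine sum_congr rfl fun x hx => ?_
  obtain ⟨hx, hn⟩ := Nat.mem_divisorsAntidiagonal.mp hx
  have h1 : (x.1 : ℝ) ≠ 0 := by rintro h; apply hn; rw [← hx, Nat.cast_eq_zero.mp h, zero_mul]
  have h2 : (x.2 : ℝ) ≠ 0 := by rintro h; apply hn; rw [← hx, Nat.cast_eq_zero.mp h, mul_zero]
  simp only [logC, coe_mk]
  rw [← hx, Nat.cast_mul, Real.log_mul h1 h2]
  push_cast
  ring

theorem pmul_mul {F : ArithmeticFunction ℂ} (hF : ∀ m n, F (m * n) = F m * F n)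
    (a b : ArithmeticFunction ℂ) : F.pmul (a * b) = F.pmul a * F.pmul b := by
  ext n
  simp only [pmul_apply, mul_apply, mul_sum]
  refine sum_congr rfl fun x hx => ?_
  rw [← (Nat.mem_divisorsAntidiagonal.mp hx).1, hF]
  ring

theorem logC_pmul_moebius_mul {F : ArithmeticFunction ℂ} (hF : ∀ m n, F (m * n) = F m * F n) :
    logC.pmul ((μ : ArithmeticFunction ℂ) * F) =
      (F.pmul vonMangoldtC - vonMangoldtC) * ((μ : ArithmeticFunction ℂ) * F) := by
  set g := (μ : ArithmeticFunction ℂ) * F with hg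
  have hζg : (ζ : ArithmeticFunction ℂ) * g = F := by
    rw [hg, ← mul_assoc, coe_zeta_mul_coe_moebius, one_mul]
  have h1 : logC.pmul F = F.pmul vonMangoldtC * F := by
    rw [pmul_comm, ← vonMangoldtC_mul_zeta, pmul_mul hF, pmul_zeta]
  have h2 : logC.pmul F = vonMangoldtC * F + (ζ : ArithmeticFunction ℂ) * logC.pmul g := by
    conv_lhs => rw [← hζg]
    rw [logC_pmul_mul, pmul_zeta, ← vonMangoldtC_mul_zeta, mul_assoc, hζg]
  have h3 : (ζ : ArithmeticFunction ℂ) * logC.pmul g =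
      (ζ : ArithmeticFunction ℂ) * ((F.pmul vonMangoldtC - vonMangoldtC) * g) := by
    rw [mul_left_comm, hζg, sub_mul, ← h1, h2]
    ring
  calc logC.pmul g = (μ : ArithmeticFunction ℂ) * ((ζ : ArithmeticFunction ℂ) * logC.pmul g) := by
        rw [← mul_assoc, coe_moebius_mul_coe_zeta, one_mul]
    _ = _ := by rw [h3, ← mul_assoc, coe_moebius_mul_coe_zeta, one_mul]

theorem log_sqrt_le (N : ℕ) : Real.log (Nat.sqrt N : ℕ) ≤ Real.log N / 2 := by
  rcases Nat.eq_zero_or_pos N with rfl | hN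
  · simp
  have h0 : 0 < Nat.sqrt N := Nat.sqrt_pos.mpr hN
  have h1 : ((Nat.sqrt N : ℕ) : ℝ) ^ 2 ≤ N := by exact_mod_cast Nat.sqrt_le' N
  have h2 := Real.log_le_log (by positivity) h1
  rw [Real.log_pow] at h2
  push_cast at h2
  linarith

/-- A monotone sequence that grows by a factor at most `√2` between `√N` and `N`
is `O(√(log N))`. -/
theorem exists_le_mul_sqrt_log {H : ℕ → ℝ} (hm : Monotone H) (hnn : ∀ n, 0 ≤ H n)
    (h : ∀ᶠ N in atTop, H N ≤ √2 * H (Nat.sqrt N)) :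
    ∃ C, ∀ N, 2 ≤ N → H N ≤ C * √(Real.log N) := by
  obtain ⟨N₀, hN₀⟩ := eventually_atTop.mp h
  set M := max N₀ 4
  have hl2 : 0 < √(Real.log 2) := Real.sqrt_pos.mpr (Real.log_pos (by norm_num))
  refine ⟨H M / √(Real.log 2), fun N => ?_⟩
  induction N using Nat.strong_induction_on with
  | _ N ih =>
    intro hN
    have hC : 0 ≤ H M / √(Real.log 2) := div_nonneg (hnn _) hl2.le
    rcases le_total N M with hNM | hNM
    · have h1 : √(Real.log 2) ≤ √(Real.log N) :=
        Real.sqrt_le_sqrt (Real.log_le_log (by norm_num) (by exact_mod_cast hN))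
      calc H N ≤ H M := hm hNM
        _ = H M / √(Real.log 2) * √(Real.log 2) := by field_simp
        _ ≤ _ := by gcongr
    · have h4 : 4 ≤ N := (le_max_right _ _).trans hNM
      have hs : 2 ≤ Nat.sqrt N := Nat.le_sqrt.mpr (by omega)
      calc H N ≤ √2 * H (Nat.sqrt N) := hN₀ N ((le_max_left _ _).trans hNM)
        _ ≤ √2 * (H M / √(Real.log 2) * √(Real.log (Nat.sqrt N : ℕ))) := by
            gcongr; exact ih _ (Nat.sqrt_lt_self (by omega)) hs
        _ ≤ √2 * (H M / √(Real.log 2) * √(Real.log N / 2)) := by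
            gcongr; exact log_sqrt_le N
        _ = _ := by
            rw [Real.sqrt_div' _ (by norm_num)]
            field_simp

theorem tendsto_log_natCast : Tendsto (fun N : ℕ => Real.log N) atTop atTop :=
  Real.tendsto_log_atTop.comp tendsto_natCast_atTop_atTop

theorem sum_div_isLittleO_log {a k : ArithmeticFunction ℝ} (ha : ∀ n, 0 ≤ a n)
    (hk : ∀ n, 0 ≤ k n) (hak : ∀ n, a n * Real.log n ≤ (k * a) n)
    (hK : (fun N : ℕ => ∑ n ∈ Ioc 0 N, k n / (n : ℝ)) =o[atTop] fun N : ℕ => Real.log N) :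
    (fun N : ℕ => ∑ n ∈ Ioc 0 N, a n / (n : ℝ)) =o[atTop] fun N : ℕ => Real.log N := by
  set H : ℕ → ℝ := fun N => ∑ n ∈ Ioc 0 N, a n / (n : ℝ) with hH
  have hnn : ∀ n, 0 ≤ H n := fun n => sum_nonneg fun i _ => div_nonneg (ha i) i.cast_nonneg
  have hm : Monotone H := fun m n hmn =>
    sum_le_sum_of_subset_of_nonneg (Ioc_subset_Ioc_right hmn)
      fun i _ _ => div_nonneg (ha i) i.cast_nonneg
  have hev : ∀ᶠ N in atTop, H N ≤ √2 * H (Nat.sqrt N) := by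
    filter_upwards [hK.bound (show (0 : ℝ) < 1 / 8 by norm_num), eventually_ge_atTop 2]
      with N hN hN2
    have hlog : 0 < Real.log N := Real.log_pos (by exact_mod_cast hN2)
    rw [Real.norm_of_nonneg hlog.le] at hN
    have hN := (le_abs_self _).trans hN
    have h1 : ∑ n ∈ Ioc 0 N, a n * Real.log n / (n : ℝ) ≤ 1 / 8 * Real.log N * H N := by
      calc _ ≤ ∑ n ∈ Ioc 0 N, (k * a) n / (n : ℝ) :=
            sum_le_sum fun n _ => by gcongr; exact hak n
        _ = ∑ n ∈ Ioc 0 N, k n / (n : ℝ) * H (N / n) := sum_mul_div_eq k a N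
        _ ≤ ∑ n ∈ Ioc 0 N, k n / (n : ℝ) * H N := by
            refine sum_le_sum fun n _ => ?_
            exact mul_le_mul_of_nonneg_left (hm (Nat.div_le_self N n))
              (div_nonneg (hk n) n.cast_nonneg)
        _ ≤ _ := by rw [← sum_mul]; gcongr; exact hnn N
    have h2 : (H N - H (Nat.sqrt N)) * (Real.log N / 2) ≤
        ∑ n ∈ Ioc 0 N, a n * Real.log n / (n : ℝ) := by
      have hsub : H N - H (Nat.sqrt N) = ∑ n ∈ Ioc (Nat.sqrt N) N, a n / (n : ℝ) := by
        rw [hH, sub_eq_iff_eq_add']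
        exact (sum_Ioc_consecutive _ (Nat.zero_le _) (Nat.sqrt_le_self N)).symm
      rw [hsub, sum_mul]
      calc _ ≤ ∑ n ∈ Ioc (Nat.sqrt N) N, a n * Real.log n / (n : ℝ) := by
            refine sum_le_sum fun n hn => ?_
            have hn' : N ≤ n ^ 2 := (Nat.sqrt_lt'.mp (mem_Ioc.mp hn).1).le
            have hl : Real.log N ≤ 2 * Real.log n := by
              have := Real.log_le_log (by positivity) (show (N : ℝ) ≤ (n : ℝ) ^ 2 by exact_mod_cast hn')
              rwa [Real.log_pow, Nat.cast_ofNat] at this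
            rw [mul_div_right_comm]
            exact mul_le_mul_of_nonneg_left (by linarith) (div_nonneg (ha n) n.cast_nonneg)
        _ ≤ _ := sum_le_sum_of_subset_of_nonneg (Ioc_subset_Ioc_left (Nat.zero_le _))
            fun i _ _ => div_nonneg (mul_nonneg (ha i) (Real.log_natCast_nonneg i)) i.cast_nonneg
    have h3 : (H N - H (Nat.sqrt N)) ≤ H N / 4 := by
      have : (H N - H (Nat.sqrt N)) * (Real.log N / 2) ≤ H N / 4 * (Real.log N / 2) := by
        linarith
      exact le_of_mul_le_mul_right this (by linarith)
    have h4 : (4 / 3 : ℝ) ≤ √2 := Real.le_sqrt_of_sq_le (by norm_num)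
    nlinarith [hnn (Nat.sqrt N)]
  obtain ⟨C, hC⟩ := exists_le_mul_sqrt_log hm hnn hev
  have hO : H =O[atTop] fun N : ℕ => √(Real.log N) := by
    refine Asymptotics.IsBigO.of_bound C ?_
    filter_upwards [eventually_ge_atTop 2] with N hN
    rw [Real.norm_of_nonneg (hnn N), Real.norm_of_nonneg (Real.sqrt_nonneg _)]
    exact hC N hN
  refine hO.trans_isLittleO ?_
  have hs : (fun x : ℝ => √x) =o[atTop] fun x : ℝ => x := by
    have h1 : (fun _ : ℝ => (1 : ℝ)) =o[atTop] fun x : ℝ => √x :=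
      (Asymptotics.isLittleO_const_id_atTop (1 : ℝ)).comp_tendsto Real.tendsto_sqrt_atTop
    refine ((Asymptotics.isBigO_refl (fun x : ℝ => √x) atTop).mul_isLittleO h1).congr'
      (.of_forall fun x => mul_one _) ?_
    filter_upwards [eventually_ge_atTop 0] with x hx using Real.mul_self_sqrt hx
  exact hs.comp_tendsto tendsto_log_natCast

theorem sum_isLittleO_natCast {a k : ArithmeticFunction ℝ} (ha : ∀ n, 0 ≤ a n)
    (hak : ∀ n, a n * Real.log n ≤ (k * a) n)
    {C : ℝ} (hC0 : 0 ≤ C) (hC : ∀ N : ℕ, ∑ n ∈ Ioc 0 N, k n ≤ C * N)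
    (hH : (fun N : ℕ => ∑ n ∈ Ioc 0 N, a n / (n : ℝ)) =o[atTop] fun N : ℕ => Real.log N) :
    (fun N : ℕ => ∑ n ∈ Ioc 0 N, a n) =o[atTop] fun N : ℕ => (N : ℝ) := by
  set H : ℕ → ℝ := fun N => ∑ n ∈ Ioc 0 N, a n / (n : ℝ)
  set T : ℕ → ℝ := fun N => ∑ n ∈ Ioc 0 N, a n
  have key : ∀ N, T N * Real.log N ≤ (C + 1) * N * H N := by
    intro N
    rcases Nat.eq_zero_or_pos N with rfl | hN
    · simp
    have hN0 : (0 : ℝ) < N := by exact_mod_cast hN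
    have h1 : ∑ n ∈ Ioc 0 N, a n * Real.log n ≤ C * N * H N := by
      calc _ ≤ ∑ n ∈ Ioc 0 N, (a * k) n := sum_le_sum fun n _ => by rw [mul_comm a]; exact hak n
        _ = ∑ n ∈ Ioc 0 N, a n * ∑ m ∈ Ioc 0 (N / n), k m := sum_Ioc_mul_eq_sum_sum a k N
        _ ≤ ∑ n ∈ Ioc 0 N, C * N * (a n / (n : ℝ)) := by
            refine sum_le_sum fun n hn => ?_
            have hn0 : (0 : ℝ) < n := by exact_mod_cast (mem_Ioc.mp hn).1
            calc _ ≤ a n * (C * (N / n : ℕ)) := mul_le_mul_of_nonneg_left (hC _) (ha n)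
              _ ≤ a n * (C * (N / n)) := by gcongr; exacts [ha n, Nat.cast_div_le]
              _ = _ := by field_simp
        _ = _ := by rw [← mul_sum]
    have h2 : ∑ n ∈ Ioc 0 N, a n * (Real.log N - Real.log n) ≤ N * H N := by
      rw [mul_sum]
      refine sum_le_sum fun n hn => ?_
      have hn0 : (0 : ℝ) < n := by exact_mod_cast (mem_Ioc.mp hn).1
      rw [← Real.log_div hN0.ne' hn0.ne', mul_div_left_comm]
      exact mul_le_mul_of_nonneg_left (Real.log_le_self (by positivity)) (ha n)
    have h3 : T N * Real.log N = ∑ n ∈ Ioc 0 N, a n * Real.log n +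
        ∑ n ∈ Ioc 0 N, a n * (Real.log N - Real.log n) := by
      rw [sum_mul, ← sum_add_distrib]
      exact sum_congr rfl fun _ _ => by ring
    linarith
  refine Asymptotics.IsLittleO.of_bound fun ε hε => ?_
  filter_upwards [hH.bound (show 0 < ε / (C + 1) by positivity), eventually_ge_atTop 2]
    with N hN hN2
  have hlog : 0 < Real.log N := Real.log_pos (by exact_mod_cast hN2)
  rw [Real.norm_of_nonneg hlog.le] at hN
  rw [Real.norm_of_nonneg (sum_nonneg fun n _ => ha n), Real.norm_of_nonneg N.cast_nonneg]
  refine le_of_mul_le_mul_right ?_ hlog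
  calc T N * Real.log N ≤ (C + 1) * N * H N := key N
    _ ≤ (C + 1) * N * (ε / (C + 1) * Real.log N) := by
        gcongr; exact (le_abs_self _).trans hN
    _ = _ := by field_simp

theorem norm_sum_mul_le {a : ℕ → ℂ} {φ E : ℕ → ℝ} {N X : ℕ} (hNX : N ≤ X)
    (hφ : ∀ n, N ≤ n → φ (n + 1) ≤ φ n) (hφ0 : ∀ n, N ≤ n → 0 ≤ φ n)
    (hE : ∀ n, N ≤ n → n ≤ X → ‖∑ i ∈ Ioc 0 n, a i‖ ≤ E n) :
    ‖∑ i ∈ Ioc N X, a i * φ i‖ ≤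
      2 * (E N * φ N) + ∑ i ∈ Ioc N X, (E i - E (i - 1)) * φ i := by
  have key : ‖∑ i ∈ Ioc N X, a i * φ i - (∑ i ∈ Ioc 0 X, a i) * φ X‖ ≤
      2 * (E N * φ N) - E X * φ X + ∑ i ∈ Ioc N X, (E i - E (i - 1)) * φ i := by
    induction X, hNX using Nat.le_induction with
    | base =>
      have := mul_le_mul_of_nonneg_right (hE N le_rfl le_rfl) (hφ0 N le_rfl)
      simp only [Ioc_self, sum_empty, zero_sub, norm_neg, norm_mul, Complex.norm_real,
        Real.norm_of_nonneg (hφ0 N le_rfl)]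
      linarith
    | succ X hNX ih =>
      have ih := ih fun n h1 h2 => hE n h1 (h2.trans X.le_succ)
      have hd : 0 ≤ φ X - φ (X + 1) := sub_nonneg.mpr (hφ X hNX)
      have h1 := mul_le_mul_of_nonneg_right (hE X hNX X.le_succ) hd
      rw [sum_Ioc_succ_top hNX, sum_Ioc_succ_top hNX, sum_Ioc_succ_top X.zero_le]
      have h2 : ∑ i ∈ Ioc N X, a i * (φ i : ℂ) + a (X + 1) * φ (X + 1) -
          (∑ i ∈ Ioc 0 X, a i + a (X + 1)) * φ (X + 1) =
          (∑ i ∈ Ioc N X, a i * (φ i : ℂ) - (∑ i ∈ Ioc 0 X, a i) * φ X) +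
            (∑ i ∈ Ioc 0 X, a i) * ((φ X - φ (X + 1) : ℝ) : ℂ) := by
        push_cast; ring
      rw [h2]
      refine (norm_add_le _ _).trans ?_
      rw [norm_mul, Complex.norm_real, Real.norm_of_nonneg hd, Nat.add_sub_cancel]
      linarith
  have h1 := norm_le_norm_sub_add (∑ i ∈ Ioc N X, a i * (φ i : ℂ)) ((∑ i ∈ Ioc 0 X, a i) * φ X)
  have h2 := mul_le_mul_of_nonneg_right (hE X hNX le_rfl) (hφ0 X hNX)
  rw [norm_mul (∑ i ∈ Ioc 0 X, a i), Complex.norm_real, Real.norm_of_nonneg (hφ0 X hNX)] at h1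
  linarith

theorem one_sub_exp_neg_div_le {u v : ℝ} (hu : 0 < u) (huv : u ≤ v) :
    (1 - Real.exp (-v)) / v ≤ (1 - Real.exp (-u)) / u := by
  have hv := hu.trans_le huv
  have h := convexOn_exp.2 (Set.mem_univ (-v)) (Set.mem_univ 0)
    (show 0 ≤ u / v by positivity) (sub_nonneg.mpr ((div_le_one hv).mpr huv)) (by ring)
  rw [smul_eq_mul, smul_eq_mul, smul_eq_mul, smul_eq_mul, mul_zero, add_zero, Real.exp_zero,
    show u / v * -v = -u by field_simp] at h
  rw [div_le_div_iff₀ hv hu]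
  have h2 := mul_le_mul_of_nonneg_right h hv.le
  have h3 : (u / v * Real.exp (-v) + (1 - u / v) * 1) * v = u * Real.exp (-v) + v - u := by
    field_simp
    ring
  linarith

theorem IsLittleO.eventually_forall_le {D : ℕ → ℂ}
    (hD : D =o[atTop] fun N : ℕ => Real.log N) {δ : ℝ} (hδ : 0 < δ) :
    ∀ᶠ N : ℕ in atTop, ∀ n ≤ N, ‖D n‖ ≤ δ * Real.log N := by
  obtain ⟨N₀, hN₀⟩ := eventually_atTop.mp (hD.bound hδ)
  have hlarge := (tendsto_log_natCast.const_mul_atTop hδ).eventually_ge_atTop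
    (∑ n ∈ range N₀, ‖D n‖)
  filter_upwards [hlarge, eventually_ge_atTop 1] with N hN hN1 n hn
  rcases lt_or_ge n N₀ with h | h
  · exact (single_le_sum (f := fun n => ‖D n‖) (fun i _ => norm_nonneg _)
      (mem_range.mpr h)).trans hN
  · refine (hN₀ n h).trans ?_
    rw [Real.norm_of_nonneg (Real.log_natCast_nonneg n)]
    rcases Nat.eq_zero_or_pos n with rfl | hn0
    · simpa using mul_nonneg hδ.le (Real.log_natCast_nonneg N)
    · gcongr

theorem norm_sum_Ioc_zero_mul_le {g : ℕ → ℂ} {N : ℕ} {δ : ℝ} (hN : 2 ≤ N)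
    (hD : ∀ n ≤ N, ‖∑ i ∈ Ioc 0 n, g i * Real.log i / i‖ ≤ δ * Real.log N) :
    ‖∑ i ∈ Ioc 0 N, g i / i * (1 - Real.exp (-(Real.log i / Real.log N)) : ℝ)‖ ≤ 2 * δ := by
  set L := Real.log N
  have hL : 0 < L := Real.log_pos (by exact_mod_cast hN)
  set φ : ℕ → ℝ := fun n =>
    if n ≤ 1 then 1 / L else (1 - Real.exp (-(Real.log n / L))) / Real.log n with hφ
  have hlog : ∀ n : ℕ, 1 < n → 0 < Real.log n := fun n hn => Real.log_pos (by exact_mod_cast hn)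
  have hφ0 : ∀ n, 0 ≤ φ n := by
    intro n
    simp only [hφ]
    split_ifs with h
    · positivity
    · have := hlog n (not_le.mp h)
      have : Real.exp (-(Real.log n / L)) ≤ 1 := Real.exp_le_one_iff.mpr (by
        rw [neg_nonpos]; positivity)
      exact div_nonneg (by linarith) (by linarith)
  have hφ1 : ∀ n, φ (n + 1) ≤ φ n := by
    intro n
    simp only [hφ]
    rcases Nat.eq_zero_or_pos n with rfl | hn
    · simp
    rw [if_neg (by omega)]
    have h1 := hlog (n + 1) (by omega)
    split_ifs with h
    · rw [div_le_div_iff₀ h1 hL]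
      have := Real.add_one_le_exp (-(Real.log (n + 1 : ℕ) / L))
      have h2 : (1 - Real.exp (-(Real.log (n + 1 : ℕ) / L))) ≤ Real.log (n + 1 : ℕ) / L := by
        linarith
      calc _ ≤ Real.log (n + 1 : ℕ) / L * L := by gcongr
        _ = _ := by field_simp
    · have h2 := hlog n (not_le.mp h)
      have h3 : Real.log n / L ≤ Real.log (n + 1 : ℕ) / L := by
        gcongr; simp
      have h4 := one_sub_exp_neg_div_le (by positivity) h3
      rw [div_div_eq_mul_div, div_div_eq_mul_div, mul_div_right_comm, mul_div_right_comm] at h4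
      exact le_of_mul_le_mul_right h4 hL
  have h := norm_sum_mul_le (a := fun i => g i * Real.log i / i) (φ := φ)
    (E := fun _ => δ * L) N.zero_le (fun n _ => hφ1 n) (fun n _ => hφ0 n) (fun n _ => hD n)
  have h0 : δ * L * φ 0 = δ := by simp only [hφ]; simp; field_simp
  simp only [sub_self, zero_mul, sum_const_zero, add_zero, h0] at h
  refine le_of_eq_of_le (congrArg _ (sum_congr rfl fun i hi => ?_)) h
  simp only [hφ]
  split_ifs with h1
  · obtain rfl : i = 1 := le_antisymm h1 (mem_Ioc.mp hi).1
    simp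
  · have h2 : (Real.log i : ℂ) ≠ 0 := by exact_mod_cast (hlog i (not_le.mp h1)).ne'
    rw [Complex.ofReal_div, div_mul_div_comm, mul_right_comm, mul_div_mul_right _ _ h2,
      div_mul_eq_mul_div]

theorem norm_sum_Ioc_mul_le {g : ℕ → ℂ} {N X : ℕ} {δ : ℝ} (hN : 2 ≤ N) (hNX : N ≤ X) (hδ : 0 ≤ δ)
    (hD : ∀ n, N ≤ n → ‖∑ i ∈ Ioc 0 n, g i * Real.log i / i‖ ≤ δ * Real.log n) :
    ‖∑ i ∈ Ioc N X, g i / i * (Real.exp (-(Real.log i / Real.log N)) : ℝ)‖ ≤ 3 * δ := by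
  set L := Real.log N
  have hL : 0 < L := Real.log_pos (by exact_mod_cast hN)
  set e : ℕ → ℝ := fun n => Real.exp (-(Real.log n / L)) with he
  set φ : ℕ → ℝ := fun n => e n / Real.log n with hφ
  have hLn : ∀ n : ℕ, N ≤ n → L ≤ Real.log n := fun n hn =>
    Real.log_le_log (by positivity) (by exact_mod_cast hn)
  have hlog : ∀ n : ℕ, N ≤ n → 0 < Real.log n := fun n hn => hL.trans_le (hLn n hn)
  have hmono : ∀ n : ℕ, N ≤ n → Real.log n ≤ Real.log (n + 1 : ℕ) := fun n hn =>
    Real.log_le_log (by exact_mod_cast (by omega : 0 < n)) (by simp)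
  have h := norm_sum_mul_le (a := fun i => g i * Real.log i / i) (φ := φ)
    (E := fun n => δ * Real.log n) hNX (fun n hn => by
      have h1 := hlog n hn
      have h2 := hmono n hn
      simp only [hφ, he]
      gcongr) (fun n hn => div_nonneg (Real.exp_pos _).le (hlog n hn).le) (fun n hn _ => hD n hn)
  have hN1 : δ * L * φ N ≤ δ := by
    have : e N ≤ 1 := Real.exp_le_one_iff.mpr (by
      rw [neg_nonpos]; exact div_nonneg hL.le hL.le)
    calc δ * L * φ N = δ * e N := by
          change δ * L * (e N / L) = _
          field_simp
      _ ≤ δ := mul_le_of_le_one_right hδ this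
  have hterm : ∀ n : ℕ, N ≤ n →
      (Real.log (n + 1 : ℕ) - Real.log n) * φ (n + 1) ≤ e n - e (n + 1) := by
    intro n hn
    have h1 := Real.add_one_le_exp ((Real.log (n + 1 : ℕ) - Real.log n) / L)
    have h2 : e n = Real.exp ((Real.log (n + 1 : ℕ) - Real.log n) / L) * e (n + 1) := by
      simp only [he]
      rw [← Real.exp_add]
      congr 1
      ring
    have hd := sub_nonneg.mpr (hmono n hn)
    have he0 : 0 ≤ e (n + 1) := (Real.exp_pos _).le
    calc _ ≤ (Real.log (n + 1 : ℕ) - Real.log n) * (e (n + 1) / L) := by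
          exact mul_le_mul_of_nonneg_left
            (div_le_div_of_nonneg_left he0 hL (hLn _ (by omega))) hd
      _ = (Real.log (n + 1 : ℕ) - Real.log n) / L * e (n + 1) := by ring
      _ ≤ _ := by rw [h2]; nlinarith
  have htel : ∑ i ∈ Ioc N X, (Real.log i - Real.log (i - 1 : ℕ)) * φ i ≤ e N - e X := by
    clear h
    induction X, hNX using Nat.le_induction with
    | base => simp
    | succ X hNX ih =>
      rw [sum_Ioc_succ_top hNX, Nat.add_sub_cancel]
      linarith [hterm X hNX]
  have hsum : ∑ i ∈ Ioc N X, (δ * Real.log i - δ * Real.log (i - 1 : ℕ)) * φ i ≤ δ := by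
    have : e N - e X ≤ 1 := by
      have h1 : e N ≤ 1 := Real.exp_le_one_iff.mpr (by
        rw [neg_nonpos]; exact div_nonneg hL.le hL.le)
      have h2 : 0 < e X := Real.exp_pos _
      linarith
    calc _ = δ * ∑ i ∈ Ioc N X, (Real.log i - Real.log (i - 1 : ℕ)) * φ i := by
          rw [mul_sum]; exact sum_congr rfl fun _ _ => by ring
      _ ≤ δ * 1 := by gcongr; exact htel.trans this
      _ = δ := mul_one δ
  refine le_trans (le_of_eq_of_le (congrArg _ (sum_congr rfl fun i hi => ?_)) h) (by linarith)
  have h2 : (Real.log i : ℂ) ≠ 0 := by exact_mod_cast (hlog i (mem_Ioc.mp hi).1.le).ne'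
  simp only [hφ, he]
  rw [Complex.ofReal_div, div_mul_div_comm, mul_right_comm, mul_div_mul_right _ _ h2,
    div_mul_eq_mul_div]

/-- If `∑_{n ≤ N} g(n) log n / n = o(log N)`, then the sums of `g(n) / n` up to `N` are close to
those smoothed by the weight `n ^ (-1 / log N)`. -/
theorem eventually_norm_sum_sub_le {g : ℕ → ℂ}
    (hD : (fun N : ℕ => ∑ i ∈ Ioc 0 N, g i * Real.log i / i) =o[atTop] fun N : ℕ => Real.log N)
    {ε : ℝ} (hε : 0 < ε) :
    ∀ᶠ N : ℕ in atTop, ∀ X ≥ N, ‖∑ i ∈ Ioc 0 N, g i / i -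
      ∑ i ∈ Ioc 0 X, g i / i * (Real.exp (-(Real.log i / Real.log N)) : ℝ)‖ ≤ ε := by
  obtain ⟨N₀, hN₀⟩ := eventually_atTop.mp (hD.bound (show 0 < ε / 5 by positivity))
  filter_upwards [IsLittleO.eventually_forall_le hD (show 0 < ε / 5 by positivity),
    eventually_ge_atTop 2, eventually_ge_atTop N₀] with N h1 hN2 hN X hX
  have hs := sum_Ioc_consecutive
    (fun i : ℕ => g i / i * (Real.exp (-(Real.log i / Real.log N)) : ℝ)) N.zero_le hX
  have ha := norm_sum_Ioc_zero_mul_le hN2 h1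
  have hb := norm_sum_Ioc_mul_le hN2 hX (by positivity : 0 ≤ ε / 5) fun n hn => by
    simpa [Real.norm_of_nonneg (Real.log_natCast_nonneg n)] using hN₀ n (hN.trans hn)
  have heq : ∑ i ∈ Ioc 0 N, g i / i -
      ∑ i ∈ Ioc 0 X, g i / i * (Real.exp (-(Real.log i / Real.log N)) : ℝ) =
      ∑ i ∈ Ioc 0 N, g i / i * (1 - Real.exp (-(Real.log i / Real.log N)) : ℝ) -
      ∑ i ∈ Ioc N X, g i / i * (Real.exp (-(Real.log i / Real.log N)) : ℝ) := by
    rw [← hs, ← sub_sub, ← sum_sub_distrib]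
    congr 1
    refine sum_congr rfl fun i _ => ?_
    push_cast
    ring
  rw [heq]
  linarith [norm_sub_le (∑ i ∈ Ioc 0 N, g i / i *
    ((1 - Real.exp (-(Real.log i / Real.log N)) : ℝ) : ℂ))
    (∑ i ∈ Ioc N X, g i / i * (Real.exp (-(Real.log i / Real.log N)) : ℝ))]

theorem tprod_eq_LSeries {f : ℕ → ℂ} (hf1 : f 1 = 1) (hf : ∀ m n : ℕ, f (m * n) = f m * f n)
    (hb : ∀ m : ℕ, ‖f m‖ ≤ 1) {F : ArithmeticFunction ℂ} (hF : ∀ n, n ≠ 0 → F n = f n)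
    {s : ℂ} (hs : 1 < s.re) :
    ∏' p : Nat.Primes, (1 - 1 / ((p : ℕ) : ℂ) ^ s) / (1 - f p / ((p : ℕ) : ℂ) ^ s) =
      LSeries (fun n => ((μ : ArithmeticFunction ℂ) * F) n) s := by
  have hs0 : s ≠ 0 := Complex.ne_zero_of_one_lt_re hs
  have hFs : LSeriesSummable F s :=
    LSeriesSummable_of_bounded_of_one_lt_re (m := 1) (fun n hn => hF n hn ▸ hb n) hs
  have hμs : LSeriesSummable ((μ : ArithmeticFunction ℂ) ·) s := LSeriesSummable_moebius_iff.mpr hs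
  rw [LSeries_mul' hμs hFs]
  set φ : ℕ →*₀ ℂ :=
    { toFun := fun n => f n * (n : ℂ) ^ (-s)
      map_zero' := by simp [hs0]
      map_one' := by simp [hf1]
      map_mul' := fun m n => by
        rw [hf, Nat.cast_mul, Complex.natCast_mul_natCast_cpow]; ring }
  have hφt : ∀ n, φ n = LSeries.term F s n := by
    intro n
    change f n * (n : ℂ) ^ (-s) = _
    rcases eq_or_ne n 0 with rfl | hn
    · simp [hs0]
    · rw [LSeries.term_of_ne_zero hn, hF n hn, Complex.cpow_neg, div_eq_mul_inv]
  have hsum : Summable fun n => ‖φ n‖ := by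
    simp only [hφt]
    exact summable_norm_iff.mpr hFs
  have h1 := EulerProduct.eulerProduct_completely_multiplicative_hasProd hsum
  have h2 := (riemannZeta_eulerProduct_hasProd hs).inv₀ (riemannZeta_ne_zero_of_one_lt_re hs)
  have h3 : (riemannZeta s)⁻¹ = LSeries ((μ : ArithmeticFunction ℂ) ·) s := by
    have := LSeries_zeta_mul_Lseries_moebius hs
    rw [LSeries_zeta_eq_riemannZeta hs] at this
    exact inv_eq_of_mul_eq_one_right this
  rw [← h3]
  have h4 : ∑' n, φ n = LSeries F s := tsum_congr hφt
  rw [← h4, ← (h2.mul h1).tprod_eq]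
  refine tprod_congr fun p => ?_
  change _ = _ * (1 - f p * ((p : ℕ) : ℂ) ^ (-s))⁻¹
  rw [inv_inv, Complex.cpow_neg, one_div, div_eq_mul_inv, div_eq_mul_inv]

theorem summable_vonMangoldt_non_primes_div :
    Summable fun n : ℕ => (if n.Prime then 0 else Λ n) / (n : ℝ) := by
  refine (vonMangoldt.summable_residueClass_non_primes_div (q := 1) (a := 1)).congr fun n => ?_
  have : vonMangoldt.residueClass (1 : ZMod 1) n = Λ n :=
    Set.indicator_of_mem (s := {n : ℕ | (n : ZMod 1) = 1}) (Subsingleton.elim _ _) _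
  rw [this]

theorem sum_norm_sub_one_mul_vonMangoldt_isLittleO {f : ℕ → ℂ} (hb : ∀ m : ℕ, ‖f m‖ ≤ 1)
    (h : (fun n : ℕ => ∑ p ∈ (Finset.range (n + 1)).filter Nat.Prime,
        ‖f p - 1‖ * Real.log p / p) =o[atTop] (fun n : ℕ => Real.log n)) :
    (fun N : ℕ => ∑ n ∈ Ioc 0 N, ‖f n - 1‖ * Λ n / (n : ℝ)) =o[atTop]
      fun N : ℕ => Real.log N := by
  have h2 : (fun _ : ℕ => 2 * ∑' n : ℕ, (if n.Prime then 0 else Λ n) / (n : ℝ)) =o[atTop]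
      fun N : ℕ => Real.log N :=
    (Asymptotics.isLittleO_const_left.mpr (Or.inr (tendsto_norm_atTop_atTop.comp
      tendsto_log_natCast)))
  refine Asymptotics.IsBigO.trans_isLittleO (Asymptotics.IsBigO.of_bound 1 ?_) (h.add h2)
  filter_upwards with N
  have hnn : ∀ n : ℕ, 0 ≤ (if n.Prime then 0 else Λ n) / (n : ℝ) := fun n => by
    split_ifs
    · simp
    · exact div_nonneg vonMangoldt_nonneg n.cast_nonneg
  rw [one_mul, Real.norm_of_nonneg (sum_nonneg fun n _ =>
    div_nonneg (mul_nonneg (norm_nonneg _) vonMangoldt_nonneg) n.cast_nonneg)]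
  refine le_trans ?_ (le_abs_self _)
  have hs : ∑ n ∈ Ioc 0 N, (if n.Prime then 0 else Λ n) / (n : ℝ) ≤
      ∑' n : ℕ, (if n.Prime then 0 else Λ n) / (n : ℝ) :=
    summable_vonMangoldt_non_primes_div.sum_le_tsum _ fun n _ => hnn n
  have hp : ∑ p ∈ (range (N + 1)).filter Nat.Prime, ‖f p - 1‖ * Real.log p / p =
      ∑ n ∈ Ioc 0 N, if n.Prime then ‖f n - 1‖ * Real.log n / (n : ℝ) else 0 := by
    rw [← sum_filter]
    refine sum_congr ?_ fun _ _ => rfl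
    ext p
    simp only [mem_filter, mem_range, mem_Ioc, Nat.lt_succ_iff]
    exact ⟨fun ⟨h, hp⟩ => ⟨⟨hp.pos, h⟩, hp⟩, fun ⟨⟨_, h⟩, hp⟩ => ⟨h, hp⟩⟩
  rw [hp]
  refine le_trans ?_ (add_le_add_right (mul_le_mul_of_nonneg_left hs zero_le_two) _)
  rw [mul_sum, ← sum_add_distrib]
  refine sum_le_sum fun n _ => ?_
  split_ifs with hn
  · rw [vonMangoldt_apply_prime hn]; simp
  · have : ‖f n - 1‖ ≤ 2 := by
      refine (norm_sub_le _ _).trans ?_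
      rw [norm_one]
      linarith [hb n]
    rw [zero_add, mul_div_assoc]
    exact mul_le_mul_of_nonneg_right this (div_nonneg vonMangoldt_nonneg n.cast_nonneg)

theorem sum_norm_sub_one_mul_vonMangoldt_le {f : ℕ → ℂ} (hb : ∀ m : ℕ, ‖f m‖ ≤ 1) (N : ℕ) :
    ∑ n ∈ Ioc 0 N, ‖f n - 1‖ * Λ n ≤ 2 * (Real.log 4 + 4) * N := by
  have hψ := Chebyshev.psi_le_const_mul_self (x := N) N.cast_nonneg
  rw [Chebyshev.psi, Nat.floor_natCast] at hψ
  calc _ ≤ ∑ n ∈ Ioc 0 N, 2 * Λ n := by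
        refine sum_le_sum fun n _ => mul_le_mul_of_nonneg_right ?_ vonMangoldt_nonneg
        refine (norm_sub_le _ _).trans ?_
        rw [norm_one]
        linarith [hb n]
    _ ≤ _ := by rw [← mul_sum, mul_assoc]; gcongr

theorem tendsto_mean_sub_tprod {f : ℕ → ℂ} (hf1 : f 1 = 1) (hf : ∀ m n : ℕ, f (m * n) = f m * f n)
    (hb : ∀ m : ℕ, ‖f m‖ ≤ 1)
    (h : (fun n : ℕ => ∑ p ∈ (Finset.range (n + 1)).filter Nat.Prime,
        ‖f p - 1‖ * Real.log p / p) =o[atTop] (fun n : ℕ => Real.log n)) :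
    Tendsto (fun n : ℕ =>
        (1 / (n : ℂ)) * ∑ m ∈ Finset.Icc 1 n, f m
          - ∏' p : Nat.Primes,
              (1 - 1 / ((p : ℕ) : ℂ) ^ (((1 + 1 / Real.log n : ℝ)) : ℂ))
                / (1 - f p / ((p : ℕ) : ℂ) ^ (((1 + 1 / Real.log n : ℝ)) : ℂ)))
      atTop (nhds 0) := by
  set F : ArithmeticFunction ℂ := ⟨fun n => if n = 0 then 0 else f n, by simp⟩
  have hFf : ∀ n, n ≠ 0 → F n = f n := fun n hn => if_neg hn
  have hF0 : F 0 = 0 := F.map_zero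
  have hFmul : ∀ m n, F (m * n) = F m * F n := by
    intro m n
    rcases eq_or_ne m 0 with rfl | hm
    · rw [zero_mul, hF0, zero_mul]
    rcases eq_or_ne n 0 with rfl | hn
    · rw [mul_zero, hF0, mul_zero]
    rw [hFf _ (mul_ne_zero hm hn), hFf _ hm, hFf _ hn, hf]
  set g : ArithmeticFunction ℂ := (moebius : ArithmeticFunction ℂ) * F with hg
  have hgF : g * (zeta : ArithmeticFunction ℂ) = F := by
    rw [hg, mul_comm, ← mul_assoc, coe_zeta_mul_coe_moebius, one_mul]
  have hlog := logC_pmul_moebius_mul hFmul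
  set κ : ArithmeticFunction ℂ := F.pmul vonMangoldtC - vonMangoldtC
  set a : ArithmeticFunction ℝ := ⟨fun n => ‖g n‖, by simp⟩
  set k : ArithmeticFunction ℝ := ⟨fun n => ‖f n - 1‖ * vonMangoldt n, by simp⟩
  have hκk : ∀ n, ‖κ n‖ = k n := by
    intro n
    rcases eq_or_ne n 0 with rfl | hn
    · simp
    change ‖F n * ((vonMangoldt n : ℝ) : ℂ) - ((vonMangoldt n : ℝ) : ℂ)‖ =
      ‖f n - 1‖ * vonMangoldt n
    rw [hFf n hn, ← sub_one_mul, norm_mul, Complex.norm_real,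
      Real.norm_of_nonneg vonMangoldt_nonneg]
  have hglog : ∀ n, g n * Real.log n = (κ * g) n := by
    intro n
    rw [← hlog, mul_comm]
    rfl
  have hak : ∀ n, a n * Real.log n ≤ (k * a) n := by
    intro n
    calc a n * Real.log n = ‖g n * Real.log n‖ := by
          rw [norm_mul, Complex.norm_real, Real.norm_of_nonneg (Real.log_natCast_nonneg n)]; rfl
      _ = ‖(κ * g) n‖ := by rw [hglog]
      _ ≤ ∑ x ∈ n.divisorsAntidiagonal, ‖κ x.1 * g x.2‖ := by
          rw [mul_apply]; exact norm_sum_le _ _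
      _ = (k * a) n := by
          rw [mul_apply]
          exact sum_congr rfl fun x _ => by rw [norm_mul, hκk]; rfl
  have ha0 : ∀ n, 0 ≤ a n := fun n => norm_nonneg (g n)
  have hk0 : ∀ n, 0 ≤ k n := fun n => hκk n ▸ norm_nonneg _
  have hK : (fun N : ℕ => ∑ n ∈ Ioc 0 N, k n / (n : ℝ)) =o[atTop] fun N : ℕ => Real.log N :=
    sum_norm_sub_one_mul_vonMangoldt_isLittleO hb h
  have hT := sum_isLittleO_natCast ha0 hak (C := 2 * (Real.log 4 + 4)) (by positivity)
    (sum_norm_sub_one_mul_vonMangoldt_le hb) (sum_div_isLittleO_log ha0 hk0 hak hK)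
  set M : ℕ → ℂ := fun N => (1 / (N : ℂ)) * ∑ m ∈ Finset.Icc 1 N, f m with hM
  set G : ℕ → ℂ := fun N => ∑ n ∈ Ioc 0 N, g n / (n : ℂ) with hG
  have hMG : Tendsto (fun N => M N - G N) atTop (nhds 0) := by
    refine squeeze_zero_norm' ?_ hT.tendsto_div_nhds_zero
    filter_upwards [eventually_ge_atTop 1] with N hN
    have hN0 : (0 : ℝ) < N := by exact_mod_cast hN
    have hN1 : (N : ℂ) ≠ 0 := by exact_mod_cast hN0.ne'
    have h1 : ∑ m ∈ Finset.Icc 1 N, f m = ∑ n ∈ Ioc 0 N, g n * ((N / n : ℕ) : ℂ) := by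
      rw [← sum_Ioc_mul_zeta_eq_sum, hgF]
      exact sum_congr rfl fun n hn => (hFf n (mem_Ioc.mp hn).1.ne').symm
    have h2 : M N - G N = ∑ n ∈ Ioc 0 N, g n * ((N / n : ℕ) - (N : ℂ) / n) / N := by
      rw [hM, hG]
      simp only
      rw [h1, mul_sum, ← sum_sub_distrib]
      refine sum_congr rfl fun n hn => ?_
      field_simp
    rw [h2, sum_div]
    refine (norm_sum_le _ _).trans (sum_le_sum fun n hn => ?_)
    rw [norm_div, norm_mul, Complex.norm_natCast]
    refine div_le_div_of_nonneg_right (mul_le_of_le_one_right (norm_nonneg _) ?_) hN0.le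
    have h3 : ((N / n : ℕ) : ℂ) - (N : ℂ) / n = (((N / n : ℕ) - (N : ℝ) / n : ℝ) : ℂ) := by
      push_cast; rfl
    rw [h3, Complex.norm_real, Real.norm_eq_abs, abs_le]
    have h4 := Nat.lt_floor_add_one ((N : ℝ) / n)
    rw [Nat.floor_div_eq_div] at h4
    have h5 : ((N / n : ℕ) : ℝ) ≤ (N : ℝ) / n := Nat.cast_div_le
    constructor <;> linarith
  obtain ⟨B, hB⟩ : ∃ B, ∀ N, ‖G N‖ ≤ B := by
    obtain ⟨B, hB⟩ := hMG.norm.bddAbove_range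
    refine ⟨1 + B, fun N => ?_⟩
    have h1 : ‖M N - G N‖ ≤ B := hB ⟨N, rfl⟩
    have h2 : ‖M N‖ ≤ 1 := by
      rw [hM]
      simp only [one_div, norm_mul, norm_inv, Complex.norm_natCast]
      have h3 : ‖∑ m ∈ Finset.Icc 1 N, f m‖ ≤ N := by
        refine (norm_sum_le_of_le _ fun m _ => hb m).trans ?_
        simp
      calc _ ≤ (N : ℝ)⁻¹ * N := by gcongr
        _ ≤ 1 := inv_mul_le_one
    have h3 := norm_sub_le (M N) (M N - G N)
    rw [sub_sub_cancel] at h3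
    linarith
  have hD : (fun N : ℕ => ∑ i ∈ Ioc 0 N, g i * Real.log i / i) =o[atTop]
      fun N : ℕ => Real.log N := by
    refine Asymptotics.IsBigO.trans_isLittleO (Asymptotics.IsBigO.of_bound B ?_) hK
    filter_upwards with N
    simp only [hglog]
    rw [sum_mul_div_eq]
    have hKn : 0 ≤ ∑ n ∈ Ioc 0 N, k n / (n : ℝ) :=
      sum_nonneg fun n _ => div_nonneg (hk0 n) n.cast_nonneg
    rw [Real.norm_of_nonneg hKn, mul_comm, sum_mul]
    refine norm_sum_le_of_le _ fun n _ => ?_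
    rw [norm_mul, norm_div, Complex.norm_natCast, hκk]
    exact mul_le_mul_of_nonneg_left (hB _) (div_nonneg (hk0 n) n.cast_nonneg)
  have hGP : Tendsto (fun N : ℕ => G N - ∏' p : Nat.Primes,
      (1 - 1 / ((p : ℕ) : ℂ) ^ (((1 + 1 / Real.log N : ℝ)) : ℂ))
        / (1 - f p / ((p : ℕ) : ℂ) ^ (((1 + 1 / Real.log N : ℝ)) : ℂ))) atTop (nhds 0) := by
    rw [tendsto_zero_iff_norm_tendsto_zero]
    refine Metric.tendsto_nhds.mpr fun ε hε => ?_
    filter_upwards [eventually_norm_sum_sub_le hD (half_pos hε), eventually_ge_atTop 2]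
      with N hN hN2
    have hL : 0 < Real.log N := Real.log_pos (by exact_mod_cast hN2)
    have hs : 1 < (((1 + 1 / Real.log N : ℝ)) : ℂ).re := by
      rw [Complex.ofReal_re]; have := one_div_pos.mpr hL; linarith
    rw [tprod_eq_LSeries hf1 hf hb hFf hs]
    have hsum : LSeriesSummable g (((1 + 1 / Real.log N : ℝ)) : ℂ) :=
      LSeriesSummable_mul (LSeriesSummable_moebius_iff.mpr hs)
        (LSeriesSummable_of_bounded_of_one_lt_re (m := 1) (fun n hn => hFf n hn ▸ hb n) hs)
    have hterm : ∀ i : ℕ, i ≠ 0 → LSeries.term g (((1 + 1 / Real.log N : ℝ)) : ℂ) i =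
        g i / i * (Real.exp (-(Real.log i / Real.log N)) : ℝ) := by
      intro i hi
      have hi0 : (i : ℂ) ≠ 0 := by exact_mod_cast hi
      rw [LSeries.term_of_ne_zero hi, Complex.ofReal_add, Complex.ofReal_one,
        Complex.cpow_add _ _ hi0, Complex.cpow_one, Complex.cpow_def_of_ne_zero hi0,
        ← Complex.natCast_log, ← Complex.ofReal_mul, ← Complex.ofReal_exp, Real.exp_neg,
        mul_one_div, Complex.ofReal_inv, ← div_div, div_eq_mul_inv (g i / i)]
    have hlim : Tendsto (fun X : ℕ => G N - ∑ i ∈ Ioc 0 X,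
        g i / i * (Real.exp (-(Real.log i / Real.log N)) : ℝ)) atTop
        (nhds (G N - LSeries g (((1 + 1 / Real.log N : ℝ)) : ℂ))) := by
      refine tendsto_const_nhds.sub ?_
      refine (hsum.hasSum.tendsto_sum_nat.comp (tendsto_add_atTop_nat 1)).congr fun X => ?_
      rw [Function.comp_apply, range_eq_Ico, sum_eq_sum_Ico_succ_bot X.succ_pos,
        LSeries.term_zero, zero_add]
      refine sum_congr ?_ fun i hi => hterm i (mem_Ioc.mp hi).1.ne'
      ext i
      simp only [mem_Ico, mem_Ioc]
      omega
    have hle : ‖G N - LSeries g (((1 + 1 / Real.log N : ℝ)) : ℂ)‖ ≤ ε / 2 :=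
      le_of_tendsto hlim.norm ((eventually_ge_atTop N).mono fun X hX => hN X hX)
    rw [dist_zero_right, norm_norm]
    exact hle.trans_lt (half_lt_self hε)
  simpa only [sub_add_sub_cancel, add_zero] using hMG.add hGP

end MeanValue

/-- Let `f : ℕ → ℂ` be completely multiplicative with `|f(m)| ≤ 1`, and
suppose `Σ_{p≤n} |f(p) − 1| (log p)/p = o(log n)`. Then
`(1/n) Σ_{m=1}^n f(m) = Π_p (1 − p^{−(1+1/log n)})/(1 − f(p) p^{−(1+1/log n)}) + o(1)`,
the product being over all primes `p`. -/
theorem stmt_19 (f : ℕ → ℂ) (hf1 : f 1 = 1) (hf : ∀ m n : ℕ, f (m * n) = f m * f n)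
    (hb : ∀ m : ℕ, ‖f m‖ ≤ 1)
    (h : (fun n : ℕ => ∑ p ∈ (Finset.range (n + 1)).filter Nat.Prime,
        ‖f p - 1‖ * Real.log p / p) =o[atTop] (fun n : ℕ => Real.log n)) :
    Tendsto (fun n : ℕ =>
        (1 / (n : ℂ)) * ∑ m ∈ Finset.Icc 1 n, f m
          - ∏' p : Nat.Primes,
              (1 - 1 / ((p : ℕ) : ℂ) ^ (((1 + 1 / Real.log n : ℝ)) : ℂ))
                / (1 - f p / ((p : ℕ) : ℂ) ^ (((1 + 1 / Real.log n : ℝ)) : ℂ)))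
      atTop (nhds 0) := by
  exact MeanValue.tendsto_mean_sub_tprod hf1 hf hb h
end
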